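/- There exists a constant M > 0 such that for every t ≥ 0 and every f ∈ ℰ there is a (necessarily unique) function S(t)f ∈ ℰ whose Fourier transform satisfies ℱ[S(t)f](ξ) = exp(−(ξ²/2)(1 − e^{−2t})) f̂(ξ e^{−t}) for a.e. ξ ∈ ℝ, and ‖S(t)f‖_ω ≤ M e^{t/2} ‖f‖_ω. -/

import Mathlib

open MeasureTheory Complex

/-- Fourier transform with the paper's normalization `f̂(ξ) = ∫ f(x) e^{−ixξ} dx`. -/
noncomputable def FT (f : ℝ → ℂ) (ξ : ℝ) : ℂ :=
  ∫ x : ℝ, f x * Complex.exp (-(Complex.I * x * ξ))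

/-- Membership in `ℰ = L²(ℝ, cosh(βx) dx)`. -/
def memE (β : ℝ) (f : ℝ → ℂ) : Prop :=
  AEStronglyMeasurable f volume ∧
    Integrable (fun x : ℝ => ‖f x‖ ^ 2 * Real.cosh (β * x))

/-- The norm `‖f‖_ω = (∫ |f|² cosh(βx) dx)^{1/2}`. -/
noncomputable def normE (β : ℝ) (f : ℝ → ℂ) : ℝ :=
  Real.sqrt (∫ x : ℝ, ‖f x‖ ^ 2 * Real.cosh (β * x))

open ProbabilityTheory FourierTransform
open scoped NNReal ContDiff

theorem Real.inv_cosh_le_four_mul_inv_one_add_sq (x : ℝ) :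
    (Real.cosh x)⁻¹ ≤ 4 * (1 + x ^ 2)⁻¹ := by
  have h₁ := Real.quadratic_le_exp_of_nonneg (abs_nonneg x)
  have h₂ : Real.cosh x = (Real.exp |x| + Real.exp (-|x|)) / 2 := by
    rw [← Real.cosh_abs, Real.cosh_eq]
  have h₃ : (1 + x ^ 2) / 4 ≤ Real.cosh x := by
    rw [h₂]
    nlinarith [Real.exp_pos (-|x|), abs_nonneg x, sq_abs x]
  calc (Real.cosh x)⁻¹ ≤ ((1 + x ^ 2) / 4)⁻¹ := by gcongr
    _ = 4 * (1 + x ^ 2)⁻¹ := by rw [inv_div]; ring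

theorem integrable_inv_cosh_mul {β : ℝ} (hβ : β ≠ 0) :
    Integrable fun x : ℝ => (Real.cosh (β * x))⁻¹ := by
  refine ((integrable_inv_one_add_sq.comp_mul_left' hβ).const_mul 4).mono'
    (by fun_prop) (.of_forall fun x => ?_)
  rw [Real.norm_of_nonneg (by positivity)]
  exact Real.inv_cosh_le_four_mul_inv_one_add_sq _

theorem memE.integrable {β : ℝ} (hβ : β ≠ 0) {f : ℝ → ℂ} (hf : memE β f) : Integrable f := by
  refine (hf.2.add (integrable_inv_cosh_mul hβ)).mono' hf.1 (.of_forall fun x => ?_)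
  have hc : 0 < Real.cosh (β * x) := Real.cosh_pos _
  have h : 0 ≤ (2 * ‖f x‖ * Real.cosh (β * x) - 1) ^ 2 := sq_nonneg _
  have e : ‖f x‖ ^ 2 * Real.cosh (β * x) + (Real.cosh (β * x))⁻¹ - ‖f x‖ =
      ((‖f x‖ * Real.cosh (β * x) - 1 / 2) ^ 2 + 3 / 4) / Real.cosh (β * x) := by
    field_simp
    ring
  have : 0 ≤ ‖f x‖ ^ 2 * Real.cosh (β * x) + (Real.cosh (β * x))⁻¹ - ‖f x‖ := by
    rw [e]; positivity
  simpa using this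

theorem integrable_mul_cexp {f : ℝ → ℂ} (hf : Integrable f) (ξ : ℝ) :
    Integrable fun x : ℝ => f x * Complex.exp (-(Complex.I * x * ξ)) := by
  refine hf.mono (hf.1.mul (by fun_prop)) (.of_forall fun x => ?_)
  simp [Complex.norm_exp]

theorem FT_congr_ae {f g : ℝ → ℂ} (h : f =ᵐ[volume] g) (ξ : ℝ) : FT f ξ = FT g ξ :=
  integral_congr_ae (h.mono fun x hx => by simp only [hx])

theorem FT_sub {f g : ℝ → ℂ} (hf : Integrable f) (hg : Integrable g) (ξ : ℝ) :
    FT (fun x => f x - g x) ξ = FT f ξ - FT g ξ := by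
  simp only [FT, sub_mul]
  exact integral_sub (integrable_mul_cexp hf ξ) (integrable_mul_cexp hg ξ)

theorem fourier_eq_FT (f : ℝ → ℂ) (w : ℝ) : 𝓕 f w = FT f (2 * Real.pi * w) := by
  rw [Real.fourier_real_eq_integral_exp_smul, FT]
  congr with x
  rw [smul_eq_mul, mul_comm]
  congr 2
  push_cast
  ring

theorem ae_eq_zero_of_FT_ae_eq_zero {f : ℝ → ℂ} (hf : Integrable f)
    (h : ∀ᵐ ξ : ℝ, FT f ξ = 0) : ∀ᵐ x : ℝ, f x = 0 := by
  have h𝓕 : ∀ᵐ w : ℝ, 𝓕 f w = 0 := by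
    have hq : Measure.QuasiMeasurePreserving (fun w : ℝ => 2 * Real.pi * w) := by
      refine ⟨by fun_prop, ?_⟩
      rw [Real.map_volume_mul_left (by positivity)]
      exact Measure.smul_absolutelyContinuous
    filter_upwards [hq.ae h] with w hw
    rw [fourier_eq_FT, hw]
  refine ae_eq_zero_of_integral_contDiff_smul_eq_zero hf.locallyIntegrable fun g hg hc => ?_
  have hg₁ : HasCompactSupport (Complex.ofRealCLM ∘ g) := hc.comp_left rfl
  have hg₂ : ContDiff ℝ ∞ (Complex.ofRealCLM ∘ g) := by fun_prop
  set φ : SchwartzMap ℝ ℂ := hg₁.toSchwartzMap hg₂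
  set ψ : SchwartzMap ℝ ℂ := 𝓕⁻ φ
  have key := VectorFourier.integral_fourierIntegral_smul_eq_flip (L := innerₗ ℝ)
    Real.continuous_fourierChar continuous_inner hf ψ.integrable (μ := volume) (ν := volume)
  have h₁ : ∀ x, VectorFourier.fourierIntegral Real.fourierChar volume (innerₗ ℝ).flip ψ x
      = (g x : ℂ) := by
    intro x
    have : 𝓕 ψ = φ := FourierTransform.fourier_fourierInv_eq φ
    rw [flip_innerₗ]
    exact congrArg (fun χ : SchwartzMap ℝ ℂ => χ x) this
  have h₂ : ∫ ξ : ℝ, (VectorFourier.fourierIntegral Real.fourierChar volume (innerₗ ℝ) f ξ) •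
      ψ ξ = 0 :=
    integral_eq_zero_of_ae (h𝓕.mono fun ξ hξ => by
      change 𝓕 f ξ • _ = _
      simp [hξ])
  rw [h₂] at key
  rw [key]
  congr with x
  rw [h₁]
  simp [mul_comm]

theorem ae_eq_of_FT_ae_eq {f g : ℝ → ℂ} (hf : Integrable f) (hg : Integrable g)
    (h : ∀ᵐ ξ : ℝ, FT f ξ = FT g ξ) : f =ᵐ[volume] g := by
  have := ae_eq_zero_of_FT_ae_eq_zero (hf.sub hg) (h.mono fun ξ hξ => by
    rw [← sub_eq_zero] at hξ
    rw [← hξ, ← FT_sub hf hg]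
    rfl)
  exact this.mono fun x hx => sub_eq_zero.1 hx

/-- The convolution of `h` with the centred Gaussian of variance `v`. -/
noncomputable def gaussConv (v : ℝ≥0) (h : ℝ → ℂ) (x : ℝ) : ℂ :=
  ∫ z, h (x - z) ∂gaussianReal 0 v

theorem integrable_cosh_gaussianReal (v : ℝ≥0) (β : ℝ) :
    Integrable (fun z => Real.cosh (β * z)) (gaussianReal 0 v) := by
  simp only [Real.cosh_eq, ← neg_mul]
  exact ((integrable_exp_mul_gaussianReal β).add (integrable_exp_mul_gaussianReal (-β))).div_const 2

theorem integrable_sinh_gaussianReal (v : ℝ≥0) (β : ℝ) :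
    Integrable (fun z => Real.sinh (β * z)) (gaussianReal 0 v) := by
  simp only [Real.sinh_eq, ← neg_mul]
  exact ((integrable_exp_mul_gaussianReal β).sub (integrable_exp_mul_gaussianReal (-β))).div_const 2

theorem integral_exp_gaussianReal (v : ℝ≥0) (β : ℝ) :
    ∫ z, Real.exp (β * z) ∂gaussianReal 0 v = Real.exp (v * β ^ 2 / 2) := by
  have := congrFun (mgf_fun_id_gaussianReal (μ := 0) (v := v)) β
  simpa [mgf] using this

theorem integral_cosh_gaussianReal (v : ℝ≥0) (β : ℝ) :
    ∫ z, Real.cosh (β * z) ∂gaussianReal 0 v = Real.exp (v * β ^ 2 / 2) := by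
  simp only [Real.cosh_eq, ← neg_mul]
  rw [integral_div, integral_add (integrable_exp_mul_gaussianReal β)
    (integrable_exp_mul_gaussianReal (-β)), integral_exp_gaussianReal, integral_exp_gaussianReal]
  simp

theorem integral_sinh_gaussianReal (v : ℝ≥0) (β : ℝ) :
    ∫ z, Real.sinh (β * z) ∂gaussianReal 0 v = 0 := by
  simp only [Real.sinh_eq, ← neg_mul]
  rw [integral_div, integral_sub (integrable_exp_mul_gaussianReal β)
    (integrable_exp_mul_gaussianReal (-β)), integral_exp_gaussianReal, integral_exp_gaussianReal]
  simp

section Convolution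

variable {v : ℝ≥0} {β : ℝ} {h : ℝ → ℂ}

theorem integrable_comp_sub_prod (hi : Integrable h) :
    Integrable (fun p : ℝ × ℝ => h (p.1 - p.2)) (volume.prod (gaussianReal 0 v)) := by
  exact (measurePreserving_sub_prod (volume : Measure ℝ)
    (gaussianReal 0 v)).integrable_comp_of_integrable (hi.comp_fst (gaussianReal 0 v))

theorem aestronglyMeasurable_gaussConv (hi : Integrable h) :
    AEStronglyMeasurable (gaussConv v h) :=
  (integrable_comp_sub_prod hi).integral_prod_left.1

theorem FT_gaussConv (hi : Integrable h) (ξ : ℝ) :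
    FT (gaussConv v h) ξ = Complex.exp (-(v * (ξ : ℂ) ^ 2 / 2)) * FT h ξ := by
  have hint : Integrable (fun p : ℝ × ℝ => h (p.1 - p.2) * Complex.exp (-(Complex.I * p.1 * ξ)))
      (volume.prod (gaussianReal 0 v)) := by
    refine (integrable_comp_sub_prod hi).mono
      ((integrable_comp_sub_prod hi).1.mul (by fun_prop)) (.of_forall fun p => ?_)
    simp [Complex.norm_exp]
  have hinner : ∀ z : ℝ, ∫ x : ℝ, h (x - z) * Complex.exp (-(Complex.I * x * ξ)) =
      Complex.exp ((-ξ : ℝ) * z * Complex.I) * FT h ξ := by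
    intro z
    rw [← integral_add_right_eq_self _ z, FT, ← integral_const_mul]
    congr with x
    rw [add_sub_cancel_right, mul_left_comm, ← Complex.exp_add]
    congr 2
    push_cast
    ring
  calc FT (gaussConv v h) ξ
      = ∫ x : ℝ, ∫ z, h (x - z) * Complex.exp (-(Complex.I * x * ξ)) ∂gaussianReal 0 v := by
        simp only [FT, gaussConv, integral_mul_const]
    _ = ∫ z, Complex.exp ((-ξ : ℝ) * z * Complex.I) * FT h ξ ∂gaussianReal 0 v := by
        rw [integral_integral_swap hint]
        simp only [hinner]
    _ = Complex.exp (-(v * (ξ : ℂ) ^ 2 / 2)) * FT h ξ := by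
        rw [integral_mul_const, ← charFun_apply_real, charFun_gaussianReal]
        congr 2
        push_cast
        ring

theorem integrable_sq_mul_sinh (hh : memE β h) :
    Integrable fun x : ℝ => ‖h x‖ ^ 2 * Real.sinh (β * x) := by
  refine hh.2.mono' ((hh.1.norm.pow 2).mul (by fun_prop)) (.of_forall fun x => ?_)
  rw [norm_mul, Real.norm_of_nonneg (by positivity), Real.norm_eq_abs]
  gcongr
  rw [← Real.cosh_abs, Real.abs_sinh]
  exact (Real.sinh_lt_cosh _).le

theorem integrable_sq_mul_cosh_add (hh : memE β h) :
    Integrable (fun p : ℝ × ℝ => ‖h p.1‖ ^ 2 * Real.cosh (β * (p.1 + p.2)))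
      (volume.prod (gaussianReal 0 v)) := by
  have := (hh.2.mul_prod (integrable_cosh_gaussianReal v β)).add
    ((integrable_sq_mul_sinh hh).mul_prod (integrable_sinh_gaussianReal v β))
  refine this.congr (.of_forall fun p => ?_)
  simp only [Pi.add_apply, mul_add, Real.cosh_add]
  ring

theorem integral_sq_mul_cosh_add (hh : memE β h) :
    ∫ p : ℝ × ℝ, ‖h p.1‖ ^ 2 * Real.cosh (β * (p.1 + p.2)) ∂(volume.prod (gaussianReal 0 v)) =
      Real.exp (v * β ^ 2 / 2) * ∫ x : ℝ, ‖h x‖ ^ 2 * Real.cosh (β * x) := by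
  have e : ∀ p : ℝ × ℝ, ‖h p.1‖ ^ 2 * Real.cosh (β * (p.1 + p.2)) =
      ‖h p.1‖ ^ 2 * Real.cosh (β * p.1) * Real.cosh (β * p.2) +
        ‖h p.1‖ ^ 2 * Real.sinh (β * p.1) * Real.sinh (β * p.2) := fun p => by
    rw [mul_add, Real.cosh_add]
    ring
  simp only [e]
  rw [integral_add (hh.2.mul_prod (integrable_cosh_gaussianReal v β))
    ((integrable_sq_mul_sinh hh).mul_prod (integrable_sinh_gaussianReal v β)),
    integral_prod_mul (fun x => ‖h x‖ ^ 2 * Real.cosh (β * x)) (fun z => Real.cosh (β * z)),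
    integral_prod_mul (fun x => ‖h x‖ ^ 2 * Real.sinh (β * x)) (fun z => Real.sinh (β * z)),
    integral_cosh_gaussianReal, integral_sinh_gaussianReal]
  ring

theorem integrable_sq_comp_sub_mul_cosh (hh : memE β h) :
    Integrable (fun p : ℝ × ℝ => ‖h (p.1 - p.2)‖ ^ 2 * Real.cosh (β * p.1))
      (volume.prod (gaussianReal 0 v)) := by
  have := (measurePreserving_sub_prod (volume : Measure ℝ)
    (gaussianReal 0 v)).integrable_comp_of_integrable (integrable_sq_mul_cosh_add hh)
  simpa [Function.comp_def] using this

theorem integral_sq_comp_sub_mul_cosh (hh : memE β h) :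
    ∫ p : ℝ × ℝ, ‖h (p.1 - p.2)‖ ^ 2 * Real.cosh (β * p.1) ∂(volume.prod (gaussianReal 0 v)) =
      Real.exp (v * β ^ 2 / 2) * ∫ x : ℝ, ‖h x‖ ^ 2 * Real.cosh (β * x) := by
  have hT := measurePreserving_sub_prod (volume : Measure ℝ) (gaussianReal 0 v)
  rw [← integral_sq_mul_cosh_add hh]
  conv_rhs => rw [← hT.map_eq]
  rw [integral_map hT.measurable.aemeasurable]
  · simp
  · rw [hT.map_eq]
    exact (integrable_sq_mul_cosh_add hh).1

theorem sq_norm_integral_le {μ : Measure ℝ} [IsProbabilityMeasure μ] {f : ℝ → ℂ}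
    (hf : Integrable f μ) (hf₂ : Integrable (fun x => ‖f x‖ ^ 2) μ) :
    ‖∫ x, f x ∂μ‖ ^ 2 ≤ ∫ x, ‖f x‖ ^ 2 ∂μ := by
  calc ‖∫ x, f x ∂μ‖ ^ 2 ≤ (∫ x, ‖f x‖ ∂μ) ^ 2 := by
        gcongr
        exact norm_integral_le_integral_norm f
    _ ≤ ∫ x, ‖f x‖ ^ 2 ∂μ :=
        (even_two.convexOn_pow (𝕜 := ℝ)).map_integral_le (by fun_prop) isClosed_univ (by simp)
          hf.norm hf₂

theorem sq_norm_gaussConv_mul_cosh_le (hi : Integrable h) (hh : memE β h) :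
    ∀ᵐ x : ℝ, ‖gaussConv v h x‖ ^ 2 * Real.cosh (β * x) ≤
      ∫ z, ‖h (x - z)‖ ^ 2 * Real.cosh (β * x) ∂gaussianReal 0 v := by
  filter_upwards [(integrable_comp_sub_prod (v := v) hi).prod_right_ae,
    (integrable_sq_comp_sub_mul_cosh (v := v) hh).prod_right_ae] with x h₁ h₂
  rw [integral_mul_const]
  gcongr
  refine sq_norm_integral_le h₁ ?_
  simpa [mul_assoc, (Real.cosh_pos (β * x)).ne'] using h₂.mul_const (Real.cosh (β * x))⁻¹

theorem memE_gaussConv (hi : Integrable h) (hh : memE β h) : memE β (gaussConv v h) := by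
  have hm := aestronglyMeasurable_gaussConv (v := v) hi
  refine ⟨hm, (integrable_sq_comp_sub_mul_cosh (v := v) hh).integral_prod_left.mono'
    ((hm.norm.pow 2).mul (by fun_prop)) ?_⟩
  filter_upwards [sq_norm_gaussConv_mul_cosh_le (v := v) hi hh] with x hx
  rwa [Real.norm_of_nonneg (by positivity)]

theorem integral_sq_gaussConv_mul_cosh_le (hi : Integrable h) (hh : memE β h) :
    ∫ x : ℝ, ‖gaussConv v h x‖ ^ 2 * Real.cosh (β * x) ≤
      Real.exp (v * β ^ 2 / 2) * ∫ x : ℝ, ‖h x‖ ^ 2 * Real.cosh (β * x) := by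
  rw [← integral_sq_comp_sub_mul_cosh hh, integral_prod _ (integrable_sq_comp_sub_mul_cosh hh)]
  exact integral_mono_ae (memE_gaussConv hi hh).2
    (integrable_sq_comp_sub_mul_cosh hh).integral_prod_left (sq_norm_gaussConv_mul_cosh_le hi hh)

end Convolution

/-- The mass-preserving dilation of `f` by the factor `c`. -/
noncomputable def dilate (c : ℝ) (f : ℝ → ℂ) (x : ℝ) : ℂ := c * f (c * x)

section Dilation

variable {β c : ℝ} {f : ℝ → ℂ}

theorem FT_dilate (hc : 0 < c) (f : ℝ → ℂ) (ξ : ℝ) : FT (dilate c f) ξ = FT f (ξ * c⁻¹) := by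
  have := Measure.integral_comp_mul_left
    (fun y : ℝ => c * (f y * Complex.exp (-(Complex.I * y * (ξ * c⁻¹ : ℝ))))) c
  rw [integral_const_mul, abs_of_pos (inv_pos.2 hc)] at this
  have hc' : (c : ℂ) ≠ 0 := by exact_mod_cast hc.ne'
  rw [FT, FT]
  calc _ = ∫ x : ℝ, (c : ℂ) * (f (c * x) *
        Complex.exp (-(Complex.I * (c * x : ℝ) * (ξ * c⁻¹ : ℝ)))) := by
        congr with x
        rw [dilate, mul_assoc]
        congr 3
        push_cast
        field_simp
    _ = _ := by
        rw [integral_const_mul, this, integral_const_mul, Complex.real_smul, ← mul_assoc,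
          Complex.ofReal_inv, inv_mul_cancel₀ hc', one_mul]

theorem sq_norm_mul_cosh_div_le (hc : 1 ≤ c) (f : ℝ → ℂ) (x : ℝ) :
    ‖f x‖ ^ 2 * Real.cosh (β * (c⁻¹ * x)) ≤ ‖f x‖ ^ 2 * Real.cosh (β * x) := by
  gcongr
  rw [Real.cosh_le_cosh, abs_mul, abs_mul, abs_mul, abs_of_nonneg (by positivity : 0 ≤ c⁻¹)]
  gcongr
  exact mul_le_of_le_one_left (abs_nonneg x) (inv_le_one_of_one_le₀ hc)

theorem integrable_sq_norm_mul_cosh_div (hc : 1 ≤ c) (hf : memE β f) :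
    Integrable fun x : ℝ => ‖f x‖ ^ 2 * Real.cosh (β * (c⁻¹ * x)) := by
  refine hf.2.mono' ((hf.1.norm.pow 2).mul (by fun_prop)) (.of_forall fun x => ?_)
  rw [Real.norm_of_nonneg (by positivity)]
  exact sq_norm_mul_cosh_div_le hc f x

theorem sq_norm_dilate_mul_cosh (hc : 0 < c) (f : ℝ → ℂ) (x : ℝ) :
    ‖dilate c f x‖ ^ 2 * Real.cosh (β * x) =
      c ^ 2 * (‖f (c * x)‖ ^ 2 * Real.cosh (β * (c⁻¹ * (c * x)))) := by
  rw [inv_mul_cancel_left₀ hc.ne', dilate, norm_mul, mul_pow, Complex.norm_real,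
    Real.norm_of_nonneg hc.le, mul_assoc]

theorem memE_dilate (hc : 1 ≤ c) (hf : memE β f) : memE β (dilate c f) := by
  have hc₀ : 0 < c := zero_lt_one.trans_le hc
  refine ⟨?_, ?_⟩
  · have hq : Measure.QuasiMeasurePreserving (fun x : ℝ => c * x) := by
      refine ⟨by fun_prop, ?_⟩
      rw [Real.map_volume_mul_left hc₀.ne']
      exact Measure.smul_absolutelyContinuous
    exact (hf.1.comp_quasiMeasurePreserving hq).const_mul (c : ℂ)
  · simp only [sq_norm_dilate_mul_cosh hc₀]
    exact ((integrable_sq_norm_mul_cosh_div hc hf).comp_mul_left' hc₀.ne').const_mul (c ^ 2)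

theorem integral_sq_norm_dilate_mul_cosh_le (hc : 1 ≤ c) (hf : memE β f) :
    ∫ x : ℝ, ‖dilate c f x‖ ^ 2 * Real.cosh (β * x) ≤
      c * ∫ x : ℝ, ‖f x‖ ^ 2 * Real.cosh (β * x) := by
  have hc₀ : 0 < c := zero_lt_one.trans_le hc
  simp only [sq_norm_dilate_mul_cosh hc₀]
  rw [integral_const_mul, Measure.integral_comp_mul_left
    (fun y : ℝ => ‖f y‖ ^ 2 * Real.cosh (β * (c⁻¹ * y))), abs_of_pos (inv_pos.2 hc₀),
    smul_eq_mul, ← mul_assoc, show c ^ 2 * c⁻¹ = c by field_simp]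
  gcongr
  · exact integrable_sq_norm_mul_cosh_div hc hf
  · exact hf.2
  · exact sq_norm_mul_cosh_div_le hc f

end Dilation

/-- there is `M > 0` such that for every `t ≥ 0` and `f ∈ ℰ` there is a
(necessarily a.e.-unique) `S(t)f ∈ ℰ` with
`ℱ[S(t)f](ξ) = exp(−(ξ²/2)(1−e^{−2t})) f̂(ξ e^{−t})` for a.e. `ξ`, and
`‖S(t)f‖_ω ≤ M e^{t/2} ‖f‖_ω`. -/
theorem semigroup_bounded (β : ℝ) (hβ : 0 < β) :
    ∃ M : ℝ, 0 < M ∧ ∀ t : ℝ, 0 ≤ t → ∀ f : ℝ → ℂ, memE β f →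
      ∃ g : ℝ → ℂ, memE β g ∧
        (∀ᵐ ξ : ℝ ∂volume,
          FT g ξ = Complex.exp (-((ξ : ℂ) ^ 2 / 2) * (1 - Real.exp (-2 * t)))
              * FT f (ξ * Real.exp (-t))) ∧
        (∀ g' : ℝ → ℂ, memE β g' →
          (∀ᵐ ξ : ℝ ∂volume,
            FT g' ξ = Complex.exp (-((ξ : ℂ) ^ 2 / 2) * (1 - Real.exp (-2 * t)))
                * FT f (ξ * Real.exp (-t))) → g' =ᵐ[volume] g) ∧
        normE β g ≤ M * Real.exp (t / 2) * normE β f := by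
  refine ⟨Real.exp (β ^ 2 / 4), Real.exp_pos _, fun t ht f hf => ?_⟩
  have hc : 1 ≤ Real.exp t := Real.one_le_exp ht
  have hv : 0 ≤ 1 - Real.exp (-2 * t) := sub_nonneg.2 (Real.exp_le_one_iff.2 (by linarith))
  set v : ℝ≥0 := ⟨1 - Real.exp (-2 * t), hv⟩
  have hv₁ : (v : ℝ) ≤ 1 := sub_le_self _ (Real.exp_pos _).le
  have hh : memE β (dilate (Real.exp t) f) := memE_dilate hc hf
  have hi := hh.integrable hβ.ne'
  have hg : memE β (gaussConv v (dilate (Real.exp t) f)) := memE_gaussConv hi hh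
  have hFT : ∀ ξ : ℝ, FT (gaussConv v (dilate (Real.exp t) f)) ξ =
      Complex.exp (-((ξ : ℂ) ^ 2 / 2) * (1 - Real.exp (-2 * t))) * FT f (ξ * Real.exp (-t)) := by
    intro ξ
    rw [FT_gaussConv hi, FT_dilate (Real.exp_pos t), ← Real.exp_neg]
    have : (v : ℂ) = 1 - Real.exp (-2 * t) := by
      rw [← Complex.ofReal_one, ← Complex.ofReal_sub]
      rfl
    rw [this]
    congr 2
    ring
  refine ⟨_, hg, .of_forall hFT, fun g' hg' h => ?_, ?_⟩
  · exact ae_eq_of_FT_ae_eq (hg'.integrable hβ.ne') (hg.integrable hβ.ne')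
      (h.mono fun ξ hξ => hξ.trans (hFT ξ).symm)
  · rw [normE, normE]
    refine Real.sqrt_le_iff.2 ⟨by positivity, ?_⟩
    have hN : 0 ≤ ∫ x : ℝ, ‖f x‖ ^ 2 * Real.cosh (β * x) :=
      integral_nonneg fun x => by positivity
    rw [mul_pow, mul_pow, Real.sq_sqrt hN, ← Real.exp_nat_mul, ← Real.exp_nat_mul]
    calc _ ≤ Real.exp (v * β ^ 2 / 2) *
          ∫ x : ℝ, ‖dilate (Real.exp t) f x‖ ^ 2 * Real.cosh (β * x) :=
          integral_sq_gaussConv_mul_cosh_le hi hh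
      _ ≤ Real.exp (β ^ 2 / 2) *
          (Real.exp t * ∫ x : ℝ, ‖f x‖ ^ 2 * Real.cosh (β * x)) := by
          gcongr
          · exact mul_le_of_le_one_left (sq_nonneg β) hv₁
          · exact integral_sq_norm_dilate_mul_cosh_le hc hf
      _ = _ := by
          rw [← mul_assoc]
          congr 3 <;> push_cast <;> ring
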